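/- (Proposition 3.1) For every fixed s > 0, the covariance of the inverse mixed stable subordinator satisfies lim_{t→∞} Cov_Y(s,t) = (s^{2α₁}/C₁²) E²_{α₁−α₂, 2α₁+1}(−C₂ s^{α₁−α₂}/C₁). -/

import Mathlib

open Real MeasureTheory Filter Topology

/-- Two-parameter Mittag-Leffler function `E_{a,b}(x)`. -/
noncomputable def ML (a b x : ℝ) : ℝ :=
  ∑' k : ℕ, x ^ k / Real.Gamma ((k : ℝ) * a + b)

/-- Second-order (three-parameter, `γ = 2`) Mittag-Leffler function `E²_{a,b}(x)`. -/
noncomputable def ML2 (a b x : ℝ) : ℝ :=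
  ∑' k : ℕ, ((k : ℝ) + 1) * x ^ k / Real.Gamma ((k : ℝ) * a + b)

/-- Renewal function `U(t)` of the inverse mixed stable subordinator. -/
noncomputable def Ufun (a1 a2 C1 C2 t : ℝ) : ℝ :=
  t ^ a1 / C1 * ML (a1 - a2) (a1 + 1) (-C2 * t ^ (a1 - a2) / C1)

/-- Renewal density `u(t)` of the inverse mixed stable subordinator. -/
noncomputable def ufun (a1 a2 C1 C2 t : ℝ) : ℝ :=
  t ^ (a1 - 1) / C1 * ML (a1 - a2) a1 (-C2 * t ^ (a1 - a2) / C1)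

/-- Covariance function of the inverse mixed stable subordinator. -/
noncomputable def CovY (a1 a2 C1 C2 s t : ℝ) : ℝ :=
  (∫ τ in (0:ℝ)..(min s t),
      (Ufun a1 a2 C1 C2 (s - τ) + Ufun a1 a2 C1 C2 (t - τ)) * ufun a1 a2 C1 C2 τ)
    - Ufun a1 a2 C1 C2 s * Ufun a1 a2 C1 C2 t

/-- Variance function of the inverse mixed stable subordinator. -/
noncomputable def VarY (a1 a2 C1 C2 t : ℝ) : ℝ := CovY a1 a2 C1 C2 t t

/-- The integral `I(s,t) = ∫₀^s U(t-τ) u(τ) dτ`. -/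
noncomputable def Ifun (a1 a2 C1 C2 s t : ℝ) : ℝ :=
  ∫ τ in (0:ℝ)..s, Ufun a1 a2 C1 C2 (t - τ) * ufun a1 a2 C1 C2 τ

/-- The constant `K(s)`. -/
noncomputable def Kfun (a1 a2 C1 C2 s : ℝ) : ℝ :=
  s ^ (a1 + 1) / (C1 * C2 * Real.Gamma a2) *
    ∑' k : ℕ, ((k : ℝ) * (a1 - a2) + a1) * (-C2 * s ^ (a1 - a2) / C1) ^ k /
      Real.Gamma ((k : ℝ) * (a1 - a2) + a1 + 2)

/-- Covariance function of the mixed fractional Poisson process. -/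
noncomputable def CovN (a1 a2 C1 C2 lam s t : ℝ) : ℝ :=
  lam * Ufun a1 a2 C1 C2 (min s t) + lam ^ 2 * CovY a1 a2 C1 C2 s t

/-- Variance function of the mixed fractional Poisson process. -/
noncomputable def VarN (a1 a2 C1 C2 lam t : ℝ) : ℝ :=
  lam * Ufun a1 a2 C1 C2 t + lam ^ 2 * VarY a1 a2 C1 C2 t

/-- Correlation function of the inverse mixed stable subordinator. -/
noncomputable def CorrY (a1 a2 C1 C2 s t : ℝ) : ℝ :=
  CovY a1 a2 C1 C2 s t /
    (Real.sqrt (VarY a1 a2 C1 C2 s) * Real.sqrt (VarY a1 a2 C1 C2 t))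

/-- Correlation function of the mixed fractional Poisson process. -/
noncomputable def CorrN (a1 a2 C1 C2 lam s t : ℝ) : ℝ :=
  CovN a1 a2 C1 C2 lam s t /
    (Real.sqrt (VarN a1 a2 C1 C2 lam s) * Real.sqrt (VarN a1 a2 C1 C2 lam t))

/-- Covariance function of the mixed fractional Poissonian noise. -/
noncomputable def CovZ (a1 a2 C1 C2 lam δ s t : ℝ) : ℝ :=
  CovN a1 a2 C1 C2 lam (s + δ) (t + δ) + CovN a1 a2 C1 C2 lam s t
    - CovN a1 a2 C1 C2 lam (s + δ) t - CovN a1 a2 C1 C2 lam s (t + δ)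

/-- Variance function of the mixed fractional Poissonian noise. -/
noncomputable def VarZ (a1 a2 C1 C2 lam δ t : ℝ) : ℝ := CovZ a1 a2 C1 C2 lam δ t t

/-- Correlation function of the mixed fractional Poissonian noise. -/
noncomputable def CorrZ (a1 a2 C1 C2 lam δ s t : ℝ) : ℝ :=
  CovZ a1 a2 C1 C2 lam δ s t /
    (Real.sqrt (VarZ a1 a2 C1 C2 lam δ s) * Real.sqrt (VarZ a1 a2 C1 C2 lam δ t))

/-- Incomplete Beta function `B(a, b; x)`. -/
noncomputable def Binc (a b x : ℝ) : ℝ :=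
  ∫ y in (0:ℝ)..x, y ^ (a - 1) * (1 - y) ^ (b - 1)

/-- The kernel `t ^ (b - 1) / Γ(b)` of the Riemann–Liouville fractional integral of order `b`. -/
noncomputable def powKer (b t : ℝ) : ℝ := t ^ (b - 1) / Real.Gamma b

lemma powKer_pos {b t : ℝ} (hb : 0 < b) (ht : 0 < t) : 0 < powKer b t :=
  div_pos (rpow_pos_of_pos ht _) (Gamma_pos_of_pos hb)

lemma integral_powKer_mul_powKer {b g t : ℝ} (hb : 0 < b) (hg : 0 < g) (ht : 0 < t) :
    ∫ s in (0 : ℝ)..t, powKer b s * powKer g (t - s) = powKer (b + g) t := by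
  have key : ∫ s in (0 : ℝ)..t, s ^ (b - 1) * (t - s) ^ (g - 1)
      = t ^ (b + g - 1) * (Real.Gamma b * Real.Gamma g / Real.Gamma (b + g)) := by
    have h := Complex.betaIntegral_scaled (b : ℂ) (g : ℂ) ht
    rw [Complex.betaIntegral_eq_Gamma_mul_div _ _ (by simpa) (by simpa)] at h
    have h2 : ((∫ s in (0 : ℝ)..t, s ^ (b - 1) * (t - s) ^ (g - 1) : ℝ) : ℂ)
        = ((t ^ (b + g - 1) * (Real.Gamma b * Real.Gamma g / Real.Gamma (b + g)) : ℝ) : ℂ) := by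
      rw [← intervalIntegral.integral_ofReal]
      have e : ((t ^ (b + g - 1) * (Real.Gamma b * Real.Gamma g / Real.Gamma (b + g)) : ℝ) : ℂ)
          = (t : ℂ) ^ ((b : ℂ) + g - 1)
            * (Complex.Gamma b * Complex.Gamma g / Complex.Gamma (b + g)) := by
        rw [← Complex.ofReal_add, Complex.Gamma_ofReal, Complex.Gamma_ofReal, Complex.Gamma_ofReal]
        push_cast [Complex.ofReal_cpow ht.le]
        ring
      rw [e, ← h]
      refine intervalIntegral.integral_congr fun x hx => ?_
      rw [Set.uIcc_of_le ht.le] at hx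
      push_cast [Complex.ofReal_cpow hx.1, Complex.ofReal_cpow (sub_nonneg.2 hx.2)]
      ring
    exact_mod_cast h2
  have h1 := (Gamma_pos_of_pos hb).ne'
  have h2 := (Gamma_pos_of_pos hg).ne'
  have h3 := (Gamma_pos_of_pos (add_pos hb hg)).ne'
  have e : ∀ s, powKer b s * powKer g (t - s)
      = (Real.Gamma b * Real.Gamma g)⁻¹ * (s ^ (b - 1) * (t - s) ^ (g - 1)) := fun s => by
    simp only [powKer]; field_simp
  simp_rw [e]
  rw [intervalIntegral.integral_const_mul, key, powKer]
  field_simp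

lemma intervalIntegrable_powKer_mul_powKer {b g t : ℝ} (hb : 0 < b) (hg : 0 < g) (ht : 0 < t) :
    IntervalIntegrable (fun s => powKer b s * powKer g (t - s)) volume 0 t :=
  intervalIntegral.intervalIntegrable_of_integral_ne_zero <| by
    rw [integral_powKer_mul_powKer hb hg ht]
    exact (powKer_pos (add_pos hb hg) ht).ne'

lemma rpow_div_Gamma_le {R z : ℝ} (hR : 0 < R) (hz : 0 < z) :
    R ^ z / Real.Gamma z ≤ z * exp R := by
  have h : exp (-R) * R ^ z ≤ Real.Gamma (z + 1) := by
    have hi := GammaIntegral_convergent (s := z + 1) (by positivity)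
    rw [Gamma_eq_integral (by positivity), ← integral_exp_neg_Ioi R, ← integral_mul_const]
    refine le_trans (setIntegral_mono_on ?_ (hi.mono_set (Set.Ioi_subset_Ioi hR.le))
      measurableSet_Ioi fun x hx => ?_) (setIntegral_mono_set hi ?_
        (Set.Ioi_subset_Ioi hR.le).eventuallyLE)
    · exact (integrableOn_exp_neg_Ioi R).mul_const _
    · rw [add_sub_cancel_right]
      exact mul_le_mul_of_nonneg_left (rpow_le_rpow hR.le (le_of_lt hx) hz.le) (exp_pos _).le
    · filter_upwards [ae_restrict_mem measurableSet_Ioi] with x hx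
      exact mul_nonneg (exp_pos _).le (rpow_nonneg (le_of_lt hx) _)
  rw [Gamma_add_one hz.ne', exp_neg] at h
  have hG := Gamma_pos_of_pos hz
  have := exp_pos R
  rw [div_le_iff₀ hG]
  calc R ^ z = exp R * ((exp R)⁻¹ * R ^ z) := by field_simp
    _ ≤ exp R * (z * Real.Gamma z) := mul_le_mul_of_nonneg_left h this.le
    _ = _ := by ring

/-- The coefficients `1 / Γ(n d + b)` decay faster than any geometric sequence. -/
lemma exists_pow_div_Gamma_le {d b : ℝ} (hd : 0 < d) (hb : 0 < b) {x : ℝ} (hx : 0 ≤ x) :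
    ∃ K, 0 ≤ K ∧ ∀ n : ℕ, x ^ n / Real.Gamma (n * d + b) ≤ K * (1 / 2) ^ n := by
  set y := 4 * x + 1
  have hy : 0 < y := by positivity
  set R := y ^ (1 / d)
  have hR : 0 < R := by positivity
  refine ⟨(d + b) * exp R / R ^ b, by positivity, fun n => ?_⟩
  have hz : 0 < n * d + b := by positivity
  have h := rpow_div_Gamma_le hR hz
  have hRn : R ^ (n * d + b) = y ^ n * R ^ b := by
    rw [rpow_add hR, ← rpow_mul hy.le, ← rpow_natCast]
    congr 2; field_simp
  have hG := Gamma_pos_of_pos hz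
  have hxy : x ^ n ≤ y ^ n * (1 / 4) ^ n := by
    rw [← mul_pow]; exact pow_le_pow_left₀ hx (by simp only [y]; linarith) n
  have hn : n * d + b ≤ (d + b) * 2 ^ n := by
    have h1 : (n : ℝ) ≤ 2 ^ n := by exact_mod_cast Nat.lt_two_pow_self.le
    have h2 : (1 : ℝ) ≤ 2 ^ n := one_le_pow₀ (by norm_num)
    nlinarith
  have hRb : 0 < R ^ b := rpow_pos_of_pos hR b
  calc x ^ n / Real.Gamma (n * d + b) ≤ y ^ n * (1 / 4) ^ n / Real.Gamma (n * d + b) := by gcongr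
    _ = R ^ (n * d + b) / Real.Gamma (n * d + b) * ((1 / 4) ^ n / R ^ b) := by
      rw [hRn]; field_simp
    _ ≤ (n * d + b) * exp R * ((1 / 4) ^ n / R ^ b) := by gcongr
    _ ≤ ((d + b) * 2 ^ n) * exp R * ((1 / 4) ^ n / R ^ b) := by gcongr
    _ = (d + b) * exp R / R ^ b * (2 ^ n * (1 / 4) ^ n) := by ring
    _ = _ := by rw [← mul_pow]; norm_num

lemma powKer_natCast_mul_add {d b t : ℝ} (ht : 0 < t) (n : ℕ) :
    powKer (n * d + b) t = t ^ (b - 1) * ((t ^ d) ^ n / Real.Gamma (n * d + b)) := by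
  rw [powKer, add_sub_assoc, rpow_add ht, mul_comm (n : ℝ) d, rpow_mul ht.le, rpow_natCast]
  ring

lemma exists_pow_mul_powKer_le {d b : ℝ} (hd : 0 < d) (hb : 0 < b) {c t : ℝ} (hc : 0 ≤ c)
    (ht : 0 < t) :
    ∃ K, 0 ≤ K ∧ ∀ n : ℕ, c ^ n * powKer (n * d + b) t ≤ K * (1 / 2) ^ n := by
  obtain ⟨K, hK, h⟩ := exists_pow_div_Gamma_le hd hb (x := c * t ^ d) (by positivity)
  refine ⟨t ^ (b - 1) * K, by positivity, fun n => ?_⟩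
  have := mul_le_mul_of_nonneg_left (h n) (rpow_nonneg ht.le (b - 1))
  rw [powKer_natCast_mul_add ht]
  calc _ = t ^ (b - 1) * ((c * t ^ d) ^ n / Real.Gamma (n * d + b)) := by rw [mul_pow]; ring
    _ ≤ _ := this
    _ = _ := by ring

lemma summable_norm_mul_powKer {d b : ℝ} (hd : 0 < d) (hb : 0 < b) {c t : ℝ} (hc : 0 ≤ c)
    (ht : 0 < t) {f : ℕ → ℝ} (hf : ∀ n, |f n| ≤ c ^ n) :
    Summable fun n : ℕ => ‖f n * powKer (n * d + b) t‖ := by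
  obtain ⟨K, hK, h⟩ := exists_pow_mul_powKer_le hd hb hc ht
  refine Summable.of_nonneg_of_le (fun _ => norm_nonneg _) (fun n => ?_)
    (summable_geometric_two.mul_left K)
  have hp := powKer_pos (b := n * d + b) (by positivity) ht
  rw [norm_mul, Real.norm_eq_abs, Real.norm_of_nonneg hp.le]
  exact (mul_le_mul_of_nonneg_right (hf n) hp.le).trans (h n)

lemma summable_norm_mul_mul_powKer {d b : ℝ} (hd : 0 < d) (hb : 0 < b) {c t : ℝ} (hc : 0 ≤ c)
    (ht : 0 < t) {f g : ℕ → ℝ} (hf : ∀ n, |f n| ≤ c ^ n) (hg : ∀ n, |g n| ≤ c ^ n) :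
    Summable fun p : ℕ × ℕ => ‖f p.1 * g p.2 * powKer ((p.1 + p.2 : ℕ) * d + b) t‖ := by
  obtain ⟨K, hK, h⟩ := exists_pow_mul_powKer_le hd hb hc ht
  have hs : Summable fun p : ℕ × ℕ => K * ((1 / 2 : ℝ) ^ p.1 * (1 / 2 : ℝ) ^ p.2) :=
    (summable_geometric_two.mul_of_nonneg summable_geometric_two
      (fun _ => by positivity) (fun _ => by positivity)).mul_left K
  refine Summable.of_nonneg_of_le (fun _ => norm_nonneg _) (fun p => ?_) hs
  have hp := powKer_pos (b := (p.1 + p.2 : ℕ) * d + b) (by positivity) ht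
  rw [norm_mul, Real.norm_of_nonneg hp.le, norm_mul, ← pow_add]
  refine le_trans (mul_le_mul_of_nonneg_right ?_ hp.le) (h (p.1 + p.2))
  rw [pow_add]
  exact mul_le_mul (hf _) (hg _) (abs_nonneg _) (by positivity)

/-- Termwise convolution of two fractional power series. -/
lemma hasSum_integral_tsum_mul_tsum {d b e : ℝ} (hd : 0 < d) (hb : 0 < b) (he : 0 < e)
    {c t : ℝ} (hc : 0 ≤ c) (ht : 0 < t) {f g : ℕ → ℝ} (hf : ∀ n, |f n| ≤ c ^ n)
    (hg : ∀ n, |g n| ≤ c ^ n) :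
    HasSum (fun p : ℕ × ℕ => f p.1 * g p.2 * powKer ((p.1 + p.2 : ℕ) * d + (b + e)) t)
      (∫ s in (0 : ℝ)..t, (∑' n : ℕ, f n * powKer (n * d + b) s)
        * ∑' n : ℕ, g n * powKer (n * d + e) (t - s)) := by
  let F : ℕ × ℕ → ℝ → ℝ := fun p s =>
    (f p.1 * powKer (p.1 * d + b) s) * (g p.2 * powKer (p.2 * d + e) (t - s))
  have hF : ∀ p s, F p s = f p.1 * g p.2
      * (powKer (p.1 * d + b) s * powKer (p.2 * d + e) (t - s)) := fun p s => by
    simp only [F]; ring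
  have hpb : ∀ n : ℕ, 0 < n * d + b := fun n => by positivity
  have hpe : ∀ n : ℕ, 0 < n * d + e := fun n => by positivity
  have hidx : ∀ p : ℕ × ℕ, (p.1 * d + b) + (p.2 * d + e) = (p.1 + p.2 : ℕ) * d + (b + e) :=
    fun p => by push_cast; ring
  have hbeta : ∀ p : ℕ × ℕ, ∫ s in Set.Ioo 0 t,
      powKer (p.1 * d + b) s * powKer (p.2 * d + e) (t - s)
        = powKer ((p.1 + p.2 : ℕ) * d + (b + e)) t := fun p => by
    rw [← integral_Ioc_eq_integral_Ioo, ← intervalIntegral.integral_of_le ht.le,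
      integral_powKer_mul_powKer (hpb _) (hpe _) ht, hidx]
  have hval : ∀ p : ℕ × ℕ, ∫ s in Set.Ioo 0 t, F p s
      = f p.1 * g p.2 * powKer ((p.1 + p.2 : ℕ) * d + (b + e)) t := fun p => by
    simp_rw [hF]
    rw [integral_const_mul, hbeta]
  have hnorm : ∀ p : ℕ × ℕ, ∫ s in Set.Ioo 0 t, ‖F p s‖
      = ‖f p.1 * g p.2 * powKer ((p.1 + p.2 : ℕ) * d + (b + e)) t‖ := fun p => by
    rw [norm_mul, Real.norm_of_nonneg
      (powKer_pos (b := (p.1 + p.2 : ℕ) * d + (b + e)) (by positivity) ht).le, ← hbeta,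
      ← integral_const_mul]
    refine setIntegral_congr_fun measurableSet_Ioo fun s hs => ?_
    simp only [hF]
    rw [norm_mul, Real.norm_of_nonneg (mul_nonneg (powKer_pos (hpb _) hs.1).le
      (powKer_pos (hpe _) (sub_pos.2 hs.2)).le)]
  have hint : ∀ p, Integrable (F p) (volume.restrict (Set.Ioo 0 t)) := fun p => by
    have h := ((intervalIntegrable_iff_integrableOn_Ioo_of_le ht.le).1
      (intervalIntegrable_powKer_mul_powKer (hpb p.1) (hpe p.2) ht)).const_mul (f p.1 * g p.2)
    exact h.congr (Eventually.of_forall fun s => (hF p s).symm)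
  have hsum := hasSum_integral_of_summable_integral_norm hint (by
    simp_rw [hnorm]
    exact summable_norm_mul_mul_powKer hd (by positivity) hc ht hf hg)
  simp_rw [hval] at hsum
  rw [intervalIntegral.integral_of_le ht.le, integral_Ioc_eq_integral_Ioo]
  have heq : ∫ s in Set.Ioo 0 t, (∑' n : ℕ, f n * powKer (n * d + b) s)
      * ∑' n : ℕ, g n * powKer (n * d + e) (t - s) = ∫ s in Set.Ioo 0 t, ∑' p, F p s :=
    setIntegral_congr_fun measurableSet_Ioo fun s hs =>
      tsum_mul_tsum_of_summable_norm (summable_norm_mul_powKer hd hb hc hs.1 hf)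
        (summable_norm_mul_powKer hd he hc (sub_pos.2 hs.2) hg)
  rw [heq]
  exact hsum

lemma continuous_ML {d b : ℝ} (hd : 0 < d) (hb : 0 < b) : Continuous (ML d b) := by
  refine continuous_iff_continuousAt.2 fun x₀ => ?_
  obtain ⟨K, hK, h⟩ := exists_pow_div_Gamma_le hd hb (x := |x₀| + 1) (by positivity)
  have hcont : ContinuousOn (ML d b) (Metric.ball 0 (|x₀| + 1)) := by
    refine continuousOn_tsum (fun n => by fun_prop) (summable_geometric_two.mul_left K)
      fun n x hx => ?_
    have hG := Gamma_pos_of_pos (show 0 < n * d + b by positivity)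
    rw [norm_div, norm_pow, Real.norm_of_nonneg hG.le]
    refine le_trans ?_ (h n)
    rw [mem_ball_zero_iff] at hx
    gcongr
  exact hcont.continuousAt (Metric.isOpen_ball.mem_nhds (by simp))

lemma ML_zero_right (d b : ℝ) : ML d b 0 = 1 / Real.Gamma b := by
  rw [ML, tsum_eq_single 0 fun n hn => by simp [hn]]
  simp

lemma ML_eq_add_mul {d b : ℝ} (hd : 0 < d) (hb : 0 < b) (x : ℝ) :
    ML d b x = 1 / Real.Gamma b + x * ML d (b + d) x := by
  have hs : Summable fun n : ℕ => x ^ n / Real.Gamma (n * d + b) := by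
    simpa [powKer, div_eq_mul_inv] using (summable_norm_mul_powKer hd hb (abs_nonneg x) one_pos
      (f := fun n => x ^ n) fun n => (abs_pow x n).le).of_norm
  rw [ML, hs.tsum_eq_zero_add, ML, ← tsum_mul_left]
  congr 1
  · simp
  · refine tsum_congr fun n => ?_
    rw [show ((n + 1 : ℕ) : ℝ) * d + b = n * d + (b + d) by push_cast; ring, pow_succ]
    ring

/-- The Prabhakar-type kernel `t ^ (b - 1) E_{d,b}(-c t ^ d)`. -/
noncomputable def mlKer (d c b t : ℝ) : ℝ := t ^ (b - 1) * ML d b (-c * t ^ d)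

lemma mlKer_eq_tsum {d c b t : ℝ} (ht : 0 < t) :
    mlKer d c b t = ∑' n : ℕ, (-c) ^ n * powKer (n * d + b) t := by
  rw [mlKer, ML, ← tsum_mul_left]
  refine tsum_congr fun n => ?_
  rw [powKer_natCast_mul_add ht, mul_pow]
  ring

lemma mlKer_eq_powKer_mul {d c b : ℝ} (hb : 0 < b) (t : ℝ) :
    mlKer d c b t = powKer b t * (Real.Gamma b * ML d b (-c * t ^ d)) := by
  have := (Gamma_pos_of_pos hb).ne'
  rw [mlKer, powKer]
  field_simp

lemma continuous_ML_comp_rpow {d c b : ℝ} (hd : 0 < d) (hb : 0 < b) :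
    Continuous fun t : ℝ => ML d b (-c * t ^ d) :=
  (continuous_ML hd hb).comp (continuous_const.mul (continuous_id.rpow_const fun _ => .inr hd.le))

lemma intervalIntegrable_mlKer_mul_powKer {d c b e t : ℝ} (hd : 0 < d) (hb : 0 < b) (he : 0 < e)
    (ht : 0 < t) :
    IntervalIntegrable (fun s => mlKer d c b s * powKer e (t - s)) volume 0 t := by
  have h := (intervalIntegrable_powKer_mul_powKer hb he ht).mul_continuousOn
    ((continuous_const (y := Real.Gamma b)).mul
      (continuous_ML_comp_rpow (c := c) hd hb)).continuousOn
  refine h.congr (fun s _ => ?_)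
  simp only [mlKer_eq_powKer_mul hb, Pi.mul_apply]
  ring

lemma intervalIntegrable_mlKer {d c b : ℝ} (hd : 0 < d) (hb : 0 < b) (x y : ℝ) :
    IntervalIntegrable (mlKer d c b) volume x y :=
  (intervalIntegral.intervalIntegrable_rpow' (by linarith)).mul_continuousOn
    (continuous_ML_comp_rpow (c := c) hd hb).continuousOn

lemma integral_mlKer_mul_powKer {d c b e t : ℝ} (hd : 0 < d) (hc : 0 ≤ c) (hb : 0 < b)
    (he : 0 < e) (ht : 0 < t) :
    ∫ s in (0 : ℝ)..t, mlKer d c b s * powKer e (t - s) = mlKer d c (b + e) t := by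
  have hg0 : ∀ n : ℕ, n ≠ 0 → (Pi.single 0 1 : ℕ → ℝ) n = 0 := fun n hn => by simp [hn]
  have h := hasSum_integral_tsum_mul_tsum hd hb he hc ht
    (f := fun n => (-c) ^ n) (g := Pi.single 0 1)
    (fun n => by rw [abs_pow, abs_neg, abs_of_nonneg hc])
    (fun n => by
      rcases eq_or_ne n 0 with rfl | hn
      · simp
      · rw [hg0 n hn]; simpa using pow_nonneg hc n)
  rw [intervalIntegral.integral_congr_Ioo_of_le ht.le
    (g := fun s => (∑' n : ℕ, (-c) ^ n * powKer (n * d + b) s)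
      * ∑' n : ℕ, (Pi.single 0 1 : ℕ → ℝ) n * powKer (n * d + e) (t - s)), ← h.tsum_eq,
    h.summable.tsum_prod, mlKer_eq_tsum ht]
  · refine tsum_congr fun n => ?_
    rw [tsum_eq_single 0 fun k hk => by simp [hg0 k hk]]
    simp
  · intro s hs
    simp only
    rw [mlKer_eq_tsum hs.1]
    congr 1
    rw [tsum_eq_single 0 fun k hk => by simp [hg0 k hk]]
    simp

lemma integral_mlKer {d c b t : ℝ} (hd : 0 < d) (hc : 0 ≤ c) (hb : 0 < b) (ht : 0 < t) :
    ∫ s in (0 : ℝ)..t, mlKer d c b s = mlKer d c (b + 1) t := by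
  rw [← integral_mlKer_mul_powKer hd hc hb one_pos ht]
  simp [powKer]

lemma integral_mlKer_mul_mlKer {d c b e t : ℝ} (hd : 0 < d) (hc : 0 ≤ c) (hb : 0 < b)
    (he : 0 < e) (ht : 0 < t) :
    ∫ s in (0 : ℝ)..t, mlKer d c b s * mlKer d c e (t - s)
      = t ^ (b + e - 1) * ML2 d (b + e) (-c * t ^ d) := by
  have hf : ∀ n : ℕ, |(-c) ^ n| ≤ c ^ n := fun n => by rw [abs_pow, abs_neg, abs_of_nonneg hc]
  have h := hasSum_integral_tsum_mul_tsum hd hb he hc ht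
    (f := fun n => (-c) ^ n) (g := fun n => (-c) ^ n) hf hf
  rw [intervalIntegral.integral_congr_Ioo_of_le ht.le
    (g := fun s => (∑' n : ℕ, (-c) ^ n * powKer (n * d + b) s)
      * ∑' n : ℕ, (-c) ^ n * powKer (n * d + e) (t - s))
    fun s hs => by rw [mlKer_eq_tsum hs.1, mlKer_eq_tsum (sub_pos.2 hs.2)], ← h.tsum_eq,
    ← Finset.HasAntidiagonal.sigmaAntidiagonalEquivProd.tsum_eq, ML2, ← tsum_mul_left]
  refine ((Finset.HasAntidiagonal.sigmaAntidiagonalEquivProd.summable_iff.2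
    h.summable).tsum_sigma' fun n => (hasSum_fintype _).summable).trans ?_
  refine tsum_congr fun n => ?_
  rw [tsum_fintype, Finset.sum_congr rfl (g := fun _ => (-c) ^ n * powKer (n * d + (b + e)) t)]
  · rw [Finset.sum_const, Finset.card_univ, Fintype.card_coe, Finset.Nat.card_antidiagonal,
      powKer_natCast_mul_add ht, nsmul_eq_mul, mul_pow]
    push_cast
    ring
  · rintro ⟨⟨i, j⟩, hij⟩ -
    have hij : i + j = n := by simpa using hij
    simp [← hij, pow_add]

lemma mlKer_eq_sub_integral {d c b t : ℝ} (hd : 0 < d) (hc : 0 ≤ c) (hb : 0 < b) (ht : 0 < t) :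
    mlKer d c b t = powKer b t - c * ∫ s in (0 : ℝ)..t, mlKer d c b s * powKer d (t - s) := by
  rw [integral_mlKer_mul_powKer hd hc hb hd ht, mlKer, mlKer, ML_eq_add_mul hd hb, powKer,
    show b + d - 1 = (b - 1) + d by ring, rpow_add ht]
  ring

lemma powKer_sub_le {d x y s : ℝ} (hd : 0 < d) (hd1 : d ≤ 1) (hs : 0 < s) (hsx : s < x)
    (hxy : x < y) : (x / y) ^ (d - 1) * powKer d (y - s) ≤ powKer d (x - s) := by
  have hx : 0 < x := hs.trans hsx
  have hy : 0 < y := hx.trans hxy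
  have hG := Gamma_pos_of_pos hd
  rw [powKer, powKer, ← mul_div_assoc, ← mul_rpow (by positivity) (by linarith)]
  refine div_le_div_of_nonneg_right (rpow_le_rpow_of_nonpos (by linarith) ?_ (by linarith)) hG.le
  rw [div_mul_eq_mul_div, le_div_iff₀ hy]
  nlinarith

lemma powKer_le_of_le {d b x y : ℝ} (hdb : d ≤ b) (hb : 0 < b) (hx : 0 < x) (hxy : x < y) :
    powKer b x ≤ (x / y) ^ (d - 1) * powKer b y := by
  have hy : 0 < y := hx.trans hxy
  have hG := Gamma_pos_of_pos hb
  have h : (x / y) ^ (b - 1) ≤ (x / y) ^ (d - 1) :=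
    rpow_le_rpow_of_exponent_ge (by positivity) ((div_le_one hy).2 hxy.le) (by linarith)
  have e : x ^ (b - 1) = (x / y) ^ (b - 1) * y ^ (b - 1) := by
    rw [← mul_rpow (by positivity) hy.le, div_mul_cancel₀ _ hy.ne']
  rw [powKer, powKer, e, mul_div_assoc]
  exact mul_le_mul_of_nonneg_right h (by positivity)

/-- Before its first zero, `mlKer d c b` is controlled by its values between the given point and
that zero. -/
lemma mlKer_le_integral {d c b x y : ℝ} (hd : 0 < d) (hd1 : d ≤ 1) (hc : 0 ≤ c) (hdb : d ≤ b)
    (hx : 0 < x) (hxy : x < y) (hpos : ∀ s, 0 < s → s < y → 0 < mlKer d c b s)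
    (hy : mlKer d c b y ≤ 0) :
    mlKer d c b x ≤ (x / y) ^ (d - 1) * (c * ∫ s in x..y, mlKer d c b s * powKer d (y - s)) := by
  have hb : 0 < b := hd.trans_le hdb
  have hy0 : 0 < y := hx.trans hxy
  have hiy := intervalIntegrable_mlKer_mul_powKer (c := c) hd hb hd hy0
  have hix := intervalIntegrable_mlKer_mul_powKer (c := c) hd hb hd hx
  have hiy1 : IntervalIntegrable (fun s => mlKer d c b s * powKer d (y - s)) volume 0 x :=
    hiy.mono_set (by
      rw [Set.uIcc_of_le hx.le, Set.uIcc_of_le hy0.le]; exact Set.Icc_subset_Icc_right hxy.le)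
  have hiy2 : IntervalIntegrable (fun s => mlKer d c b s * powKer d (y - s)) volume x y :=
    hiy.mono_set (by
      rw [Set.uIcc_of_le hxy.le, Set.uIcc_of_le hy0.le]; exact Set.Icc_subset_Icc_left hx.le)
  rw [mlKer_eq_sub_integral hd hc hb hy0,
    ← intervalIntegral.integral_add_adjacent_intervals hiy1 hiy2] at hy
  rw [mlKer_eq_sub_integral hd hc hb hx]
  have hρ : 0 < (x / y) ^ (d - 1) := by positivity
  have h1 : (x / y) ^ (d - 1) * ∫ s in (0 : ℝ)..x, mlKer d c b s * powKer d (y - s)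
      ≤ ∫ s in (0 : ℝ)..x, mlKer d c b s * powKer d (x - s) := by
    rw [← intervalIntegral.integral_const_mul]
    refine intervalIntegral.integral_mono_on_of_le_Ioo hx.le (hiy1.const_mul _) hix fun s hs => ?_
    have := mul_le_mul_of_nonneg_left (powKer_sub_le hd hd1 hs.1 hs.2 hxy)
      (hpos s hs.1 (hs.2.trans hxy)).le
    linarith
  have h2 := powKer_le_of_le hdb hb hx hxy
  have h3 := mul_le_mul_of_nonneg_left h1 hc
  have h4 := mul_le_mul_of_nonneg_left hy hρ.le
  linarith

lemma integral_powKer_sub_left {d x y : ℝ} (hd : 0 < d) :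
    ∫ s in x..y, powKer d (y - s) = (y - x) ^ d / (d * Real.Gamma d) := by
  rw [intervalIntegral.integral_comp_sub_left (fun s => powKer d s), sub_self]
  simp only [powKer]
  rw [intervalIntegral.integral_div, integral_rpow (.inl (by linarith)), sub_add_cancel,
    zero_rpow hd.ne', sub_zero, div_div]

lemma intervalIntegrable_powKer_sub_left {d x y : ℝ} (hd : 0 < d) (z : ℝ) :
    IntervalIntegrable (fun s => powKer d (z - s)) volume x y := by
  have h := (intervalIntegral.intervalIntegrable_rpow' (a := z - x) (b := z - y)
    (r := d - 1) (by linarith)).div_const (Real.Gamma d)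
  simpa [powKer] using h.comp_sub_left z

/-- Positivity of the Mittag-Leffler function on the negative half-line. -/
lemma ML_neg_mul_rpow_pos {d c b t : ℝ} (hd : 0 < d) (hd1 : d ≤ 1) (hc : 0 ≤ c) (hdb : d ≤ b)
    (ht : 0 ≤ t) : 0 < ML d b (-c * t ^ d) := by
  have hb : 0 < b := hd.trans_le hdb
  have hG := Gamma_pos_of_pos hb
  have hGd := Gamma_pos_of_pos hd
  have hF := continuous_ML_comp_rpow (c := c) hd hb
  by_contra! hneg
  obtain ⟨y, ⟨⟨hy0, -⟩, hyneg⟩, hymin⟩ : ∃ y, IsLeast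
      (Set.Icc 0 t ∩ {x | ML d b (-c * x ^ d) ≤ 0}) y :=
    (isCompact_Icc.inter_right (isClosed_le hF continuous_const)).exists_isLeast
      ⟨t, ⟨ht, le_rfl⟩, hneg⟩
  have hymem : y ≤ t := hymin ⟨⟨ht, le_rfl⟩, hneg⟩
  have hy : 0 < y := hy0.lt_of_ne fun h => by
    rw [Set.mem_ofPred_eq, ← h, zero_rpow hd.ne', mul_zero, ML_zero_right] at hyneg
    exact absurd hyneg (not_le.2 (by positivity))
  have hpos : ∀ s, 0 < s → s < y → 0 < mlKer d c b s := fun s hs hsy => by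
    refine mul_pos (rpow_pos_of_pos hs _) (not_le.1 fun h => ?_)
    exact absurd (hymin ⟨⟨hs.le, hsy.le.trans hymem⟩, h⟩) (not_le.2 hsy)
  have hyle : mlKer d c b y ≤ 0 := mul_nonpos_of_nonneg_of_nonpos (by positivity) hyneg
  obtain ⟨η, hη, hη0, hηy⟩ : ∃ η, 2 * (c * (η ^ d / (d * Real.Gamma d))) < 1 ∧ 0 < η
      ∧ η < y / 2 := by
    have hc0 : ContinuousAt (fun η : ℝ => 2 * (c * (η ^ d / (d * Real.Gamma d)))) 0 := by
      have := (continuous_id.rpow_const fun _ => .inr hd.le : Continuous fun η : ℝ => η ^ d)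
      exact (continuous_const.mul (continuous_const.mul (this.div_const _))).continuousAt
    have h1 := (hc0.eventually_lt_const (u := 1)
      (by simp [zero_rpow hd.ne'])).filter_mono (nhdsWithin_le_nhds (s := Set.Ioi 0))
    have h2 : ∀ᶠ η : ℝ in 𝓝[>] 0, η ∈ Set.Ioo 0 (y / 2) := Ioo_mem_nhdsGT (by positivity)
    obtain ⟨η, h1, h2, h3⟩ := (h1.and h2).exists
    exact ⟨η, h1, h2, h3⟩
  have hcont : ContinuousOn (mlKer d c b) (Set.Icc (y - η) y) := by
    refine ContinuousOn.mul (fun s hs => ?_) hF.continuousOn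
    exact (continuousAt_rpow_const _ _ (.inl (by linarith [hs.1]))).continuousWithinAt
  obtain ⟨x, hx, hmax⟩ := isCompact_Icc.exists_isMaxOn
    (Set.nonempty_Icc.2 (by linarith : y - η ≤ y)) hcont
  have hM : 0 < mlKer d c b x := (hpos (y - η) (by linarith) (by linarith)).trans_le
    (hmax ⟨le_rfl, by linarith⟩)
  have hxy : x < y := hx.2.lt_of_ne fun h => absurd hyle (not_le.2 (h ▸ hM))
  have hx2 : y / 2 ≤ x := by linarith [hx.1]
  have hx0 : 0 < x := by linarith
  have key := mlKer_le_integral hd hd1 hc hdb hx0 hxy hpos hyle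
  have hρ : (x / y) ^ (d - 1) ≤ 2 := by
    calc (x / y) ^ (d - 1) ≤ (1 / 2 : ℝ) ^ (d - 1) :=
          rpow_le_rpow_of_nonpos (by norm_num) (by rw [le_div_iff₀ hy]; linarith) (by linarith)
      _ ≤ (1 / 2 : ℝ) ^ (-1 : ℝ) :=
          rpow_le_rpow_of_exponent_ge (by norm_num) (by norm_num) (by linarith)
      _ = 2 := by norm_num [rpow_neg_one]
  have hint : ∫ s in x..y, mlKer d c b s * powKer d (y - s)
      ≤ mlKer d c b x * (η ^ d / (d * Real.Gamma d)) := by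
    calc _ ≤ ∫ s in x..y, mlKer d c b x * powKer d (y - s) := by
          refine intervalIntegral.integral_mono_on_of_le_Ioo hxy.le ?_
            ((intervalIntegrable_powKer_sub_left hd y).const_mul _) fun s hs => ?_
          · refine (intervalIntegrable_mlKer_mul_powKer hd hb hd hy).mono_set ?_
            rw [Set.uIcc_of_le hxy.le, Set.uIcc_of_le hy.le]
            exact Set.Icc_subset_Icc_left hx0.le
          · exact mul_le_mul_of_nonneg_right (hmax ⟨hx.1.trans hs.1.le, hs.2.le⟩)
              (powKer_pos hd (sub_pos.2 hs.2)).le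
      _ = mlKer d c b x * ((y - x) ^ d / (d * Real.Gamma d)) := by
          rw [intervalIntegral.integral_const_mul, integral_powKer_sub_left hd]
      _ ≤ _ := by
          refine mul_le_mul_of_nonneg_left (div_le_div_of_nonneg_right
            (rpow_le_rpow (by linarith) (by linarith [hx.1]) hd.le) (by positivity)) hM.le
  have h1 : (x / y) ^ (d - 1) * (c * ∫ s in x..y, mlKer d c b s * powKer d (y - s))
      ≤ 2 * (c * (mlKer d c b x * (η ^ d / (d * Real.Gamma d)))) :=
    (mul_le_mul_of_nonneg_left (mul_le_mul_of_nonneg_left hint hc) (by positivity)).trans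
      (mul_le_mul_of_nonneg_right hρ (by positivity))
  nlinarith

lemma mlKer_pos {d c b t : ℝ} (hd : 0 < d) (hd1 : d ≤ 1) (hc : 0 ≤ c) (hdb : d ≤ b)
    (ht : 0 < t) : 0 < mlKer d c b t :=
  mul_pos (rpow_pos_of_pos ht _) (ML_neg_mul_rpow_pos hd hd1 hc hdb ht.le)

lemma mlKer_le_powKer {d c b t : ℝ} (hd : 0 < d) (hd1 : d ≤ 1) (hc : 0 ≤ c) (hdb : d ≤ b)
    (ht : 0 < t) : mlKer d c b t ≤ powKer b t := by
  have hb : 0 < b := hd.trans_le hdb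
  rw [mlKer_eq_sub_integral hd hc hb ht, integral_mlKer_mul_powKer hd hc hb hd ht]
  have := mul_nonneg hc (mlKer_pos hd hd1 hc (b := b + d) (by linarith) ht).le
  linarith

lemma continuous_mlKer {d c b : ℝ} (hd : 0 < d) (hb : 1 ≤ b) : Continuous (mlKer d c b) :=
  (continuous_id.rpow_const fun _ => .inr (by linarith)).mul
    (continuous_ML_comp_rpow hd (by linarith))

/-- Increments of the renewal function over a bounded window are small far away. -/
lemma abs_mlKer_sub_le {d c b s t x : ℝ} (hd : 0 < d) (hd1 : d ≤ 1) (hc : 0 ≤ c) (hdb : d ≤ b)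
    (hb1 : b ≤ 1) (hx : x ∈ Set.Ioc 0 s) (hst : s < t) :
    |mlKer d c (b + 1) (t - x) - mlKer d c (b + 1) t| ≤ s * powKer b (t - s) := by
  have hb : 0 < b := hd.trans_le hdb
  have hs : 0 < s := hx.1.trans_le hx.2
  have hpk := powKer_pos hb (sub_pos.2 hst)
  rw [← integral_mlKer hd hc hb (by linarith [hx.2] : 0 < t - x),
    ← integral_mlKer hd hc hb (hs.trans hst), abs_sub_comm,
    intervalIntegral.integral_interval_sub_left (intervalIntegrable_mlKer hd hb _ _)
      (intervalIntegrable_mlKer hd hb _ _)]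
  have h := intervalIntegral.norm_integral_le_of_norm_le_const (a := t - x) (b := t)
    (f := mlKer d c b) (C := powKer b (t - s)) fun y hy => by
      rw [Set.uIoc_of_le (by linarith [hx.1])] at hy
      have hy0 : 0 < y := by linarith [hx.2, hy.1]
      rw [Real.norm_of_nonneg (mlKer_pos hd hd1 hc hdb hy0).le]
      refine (mlKer_le_powKer hd hd1 hc hdb hy0).trans ?_
      exact div_le_div_of_nonneg_right (rpow_le_rpow_of_nonpos (by linarith)
        (by linarith [hx.2, hy.1]) (by linarith)) (Gamma_pos_of_pos hb).le
  rw [sub_sub_cancel, abs_of_pos hx.1, Real.norm_eq_abs] at h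
  refine h.trans ?_
  rw [mul_comm]
  exact mul_le_mul_of_nonneg_right hx.2 hpk.le

lemma tendsto_integral_mlKer_sub_mul {d c b s : ℝ} (hd : 0 < d) (hd1 : d ≤ 1) (hc : 0 ≤ c)
    (hdb : d ≤ b) (hb1 : b < 1) (hs : 0 < s) :
    Tendsto (fun t => ∫ x in (0 : ℝ)..s,
      (mlKer d c (b + 1) (t - x) - mlKer d c (b + 1) t) * mlKer d c b x) atTop (𝓝 0) := by
  have hb : 0 < b := hd.trans_le hdb
  have hlim : Tendsto (fun t => s * powKer b (t - s) * mlKer d c (b + 1) s) atTop (𝓝 0) := by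
    have h1 : Tendsto (fun t : ℝ => (t - s) ^ (-(1 - b))) atTop (𝓝 0) :=
      (tendsto_rpow_neg_atTop (by linarith)).comp (tendsto_atTop_add_const_right _ (-s) tendsto_id)
    have h2 := ((h1.div_const (Real.Gamma b)).const_mul s).mul_const (mlKer d c (b + 1) s)
    simpa [powKer] using h2
  refine squeeze_zero_norm' ?_ hlim
  filter_upwards [eventually_gt_atTop s] with t ht
  rw [← integral_mlKer hd hc hb hs, ← intervalIntegral.integral_const_mul]
  refine intervalIntegral.norm_integral_le_of_norm_le hs.le (Eventually.of_forall fun x hx => ?_)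
    ((intervalIntegrable_mlKer hd hb _ _).const_mul _)
  have hpos := mlKer_pos hd hd1 hc hdb hx.1
  rw [norm_mul, Real.norm_of_nonneg hpos.le, Real.norm_eq_abs]
  exact mul_le_mul_of_nonneg_right (abs_mlKer_sub_le hd hd1 hc hdb hb1.le hx ht) hpos.le

lemma Ufun_eq_mlKer (a1 a2 C1 C2 t : ℝ) :
    Ufun a1 a2 C1 C2 t = mlKer (a1 - a2) (C2 / C1) (a1 + 1) t / C1 := by
  rw [Ufun, mlKer, add_sub_cancel_right, mul_div_right_comm, neg_div, mul_div_right_comm]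

lemma ufun_eq_mlKer (a1 a2 C1 C2 t : ℝ) :
    ufun a1 a2 C1 C2 t = mlKer (a1 - a2) (C2 / C1) a1 t / C1 := by
  rw [ufun, mlKer, mul_div_right_comm, neg_div, mul_div_right_comm]

lemma CovY_eq_add_integral {a1 a2 C1 C2 s t : ℝ} (ha2 : 0 < a2) (ha12 : a2 < a1) (hC1 : 0 < C1)
    (hC2 : 0 ≤ C2) (hs : 0 < s) (hst : s ≤ t) :
    CovY a1 a2 C1 C2 s t = s ^ (2 * a1) / C1 ^ 2
        * ML2 (a1 - a2) (2 * a1 + 1) (-C2 * s ^ (a1 - a2) / C1)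
      + (∫ x in (0 : ℝ)..s, (mlKer (a1 - a2) (C2 / C1) (a1 + 1) (t - x)
          - mlKer (a1 - a2) (C2 / C1) (a1 + 1) t) * mlKer (a1 - a2) (C2 / C1) a1 x) / C1 ^ 2 := by
  have hd : 0 < a1 - a2 := sub_pos.2 ha12
  have ha1 : 0 < a1 := ha2.trans ha12
  have hc : 0 ≤ C2 / C1 := by positivity
  rw [CovY, min_eq_left hst]
  simp_rw [Ufun_eq_mlKer, ufun_eq_mlKer]
  set U := mlKer (a1 - a2) (C2 / C1) (a1 + 1) with hU
  set u := mlKer (a1 - a2) (C2 / C1) a1 with hu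
  have hUc : Continuous U := continuous_mlKer hd (by linarith)
  have hui : IntervalIntegrable u volume 0 s := intervalIntegrable_mlKer hd ha1 _ _
  have hconv : ∫ x in (0 : ℝ)..s, u x * U (s - x)
      = s ^ (2 * a1) * ML2 (a1 - a2) (2 * a1 + 1) (-C2 * s ^ (a1 - a2) / C1) := by
    rw [integral_mlKer_mul_mlKer hd hc ha1 (by linarith) hs]
    ring_nf
  have hUs : U s = ∫ x in (0 : ℝ)..s, u x := (integral_mlKer hd hc ha1 hs).symm
  have hi1 : IntervalIntegrable (fun x => u x * U (s - x)) volume 0 s :=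
    hui.mul_continuousOn (hUc.comp (continuous_const.sub continuous_id)).continuousOn
  have hi2 : IntervalIntegrable (fun x => (U (t - x) - U t) * u x) volume 0 s :=
    hui.continuousOn_mul
      ((hUc.comp (continuous_const.sub continuous_id)).sub continuous_const).continuousOn
  have hsplit : ∀ x, (U (s - x) / C1 + U (t - x) / C1) * (u x / C1)
      = (C1 ^ 2)⁻¹ * (u x * U (s - x) + (U (t - x) - U t) * u x + U t * u x) := fun x => by
    field_simp
    ring
  simp_rw [hsplit]
  rw [intervalIntegral.integral_const_mul, intervalIntegral.integral_add (hi1.add hi2)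
    (hui.const_mul _), intervalIntegral.integral_add hi1 hi2, intervalIntegral.integral_const_mul,
    hconv, hUs]
  field_simp
  ring

/-- Proposition 3.1: for every fixed `s > 0`,
`Cov_Y(s,t) → (s^{2α₁}/C₁²) E²_{α₁-α₂, 2α₁+1}(-C₂ s^{α₁-α₂}/C₁)` as `t → ∞`. -/
theorem stmt_4 (a1 a2 C1 C2 : ℝ) (ha2 : 0 < a2) (ha12 : a2 < a1) (ha1 : a1 < 1)
    (hC1 : 0 < C1) (hC2 : 0 < C2) (hC : C1 + C2 = 1) (s : ℝ) (hs : 0 < s) :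
    Tendsto (fun t : ℝ => CovY a1 a2 C1 C2 s t) atTop
      (𝓝 (s ^ (2 * a1) / C1 ^ 2
        * ML2 (a1 - a2) (2 * a1 + 1) (-C2 * s ^ (a1 - a2) / C1))) := by
  have h := (tendsto_integral_mlKer_sub_mul (d := a1 - a2) (c := C2 / C1) (sub_pos.2 ha12)
    (by linarith) (by positivity) (by linarith : a1 - a2 ≤ a1) ha1 hs).div_const (C1 ^ 2)
  have h2 := h.const_add (s ^ (2 * a1) / C1 ^ 2
    * ML2 (a1 - a2) (2 * a1 + 1) (-C2 * s ^ (a1 - a2) / C1))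
  rw [zero_div, add_zero] at h2
  refine h2.congr' ?_
  filter_upwards [eventually_ge_atTop s] with t ht
  exact (CovY_eq_add_integral ha2 ha12 hC1 hC2.le hs ht).symm
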